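/- arXiv:1711.01622 — 6 statements merged into one kernel-verified Lean document; each statement's English description precedes it below -/
import Mathlib

section
/- Let G be a Ferrers graph. If an orientation of G contains a directed cycle, then it contains a directed cycle of length 4. -/
/-- A Ferrers graph is a bipartite graph on top vertices `t_0,…,t_k` and
bottom vertices `b_1,…,b_m` (here `b_j` is indexed by `0 ≤ j < m`), whose edge set is
down-closed in both coordinates and contains `(t_0,b_{m-1})` and `(t_k,b_0)`.
An orientation assigns a direction to each edge: `dir i j = true` means `t_i → b_j`.
If the orientation contains a directed cycle, then it contains a directed 4-cycle. -/
theorem ferrers_orientation_cycle_implies_four_cycle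
    (k m : ℕ) (hm : 0 < m)
    (edge : ℕ → ℕ → Prop)
    (hbound : ∀ i j, edge i j → i ≤ k ∧ j < m)
    (hdown : ∀ i j r s, edge i j → r ≤ i → s ≤ j → edge r s)
    (hc1 : edge 0 (m - 1)) (hc2 : edge k 0)
    (dir : ℕ → ℕ → Bool)
    (hcycle : ∃ (ℓ : ℕ) (t b : ℕ → ℕ), 2 ≤ ℓ ∧
      (∀ q q', q < ℓ → q' < ℓ → q ≠ q' → t q ≠ t q' ∧ b q ≠ b q') ∧
      (∀ q, q < ℓ → edge (t q) (b q) ∧ dir (t q) (b q) = true) ∧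
      (∀ q, q < ℓ → edge (t ((q + 1) % ℓ)) (b q) ∧ dir (t ((q + 1) % ℓ)) (b q) = false)) :
    ∃ i i' j j', i ≠ i' ∧ j ≠ j' ∧
      edge i j ∧ dir i j = true ∧
      edge i' j ∧ dir i' j = false ∧
      edge i' j' ∧ dir i' j' = true ∧
      edge i j' ∧ dir i j' = false := by
  obtain ⟨l, t, b, hl, -, h1, h2⟩ := hcycle
  have hl0 : 0 < l := by omega
  obtain ⟨p, hp, hmin⟩ := Finset.exists_min_image (Finset.range l) t ⟨0, by simpa using hl0⟩
  have hp' : p < l := by simpa using hp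
  have hE : ∀ q, edge (t p) (b (q % l)) := fun q =>
    hdown _ _ _ _ (h1 _ (Nat.mod_lt q hl0)).1
      (hmin _ (by simpa using Nat.mod_lt q hl0)) le_rfl
  by_contra hno
  have hall : ∀ n, dir (t p) (b ((p + n) % l)) = true := by
    intro n
    induction n with
    | zero => simpa [Nat.mod_eq_of_lt hp'] using (h1 p hp').2
    | succ n ih =>
      by_contra hf
      rw [Bool.not_eq_true] at hf
      have a1 := h2 _ (Nat.mod_lt (p + n) hl0)
      rw [Nat.mod_add_mod, Nat.add_assoc] at a1
      have a2 := h1 _ (Nat.mod_lt (p + (n + 1)) hl0)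
      refine hno ⟨t p, t ((p + (n + 1)) % l), b ((p + n) % l), b ((p + (n + 1)) % l),
        ?_, ?_, hE _, ih, a1.1, a1.2, a2.1, a2.2, hE _, hf⟩
      · intro h
        have := a1.2
        rw [← h, ih] at this
        cases this
      · intro h
        rw [← h, ih] at hf
        cases hf
  have a := (h2 _ (Nat.mod_lt (p + (l - 1)) hl0)).2
  rw [Nat.mod_add_mod, show p + (l - 1) + 1 = p + l by omega, Nat.add_mod_right,
    Nat.mod_eq_of_lt hp', hall] at a
  cases a
end

section
/- Let F be a Ferrers diagram and G(F) its Ferrers graph. The map sending an EW-tableau T of shape F to the orientation of G(F) in which the edge (t_i,b_j) is directed from t_i to b_j if the cell of T in row t_i and column b_j contains a 0, and from b_j to t_i if it contains a 1, is a bijection from the set of EW-tableaux of shape F onto the set of acyclic orientations of G(F) whose unique sink is t_0. -/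
/-- A Ferrers diagram (shape): `r` rows; row `i` (for `i < r`) has `len i` cells,
left-aligned, with row lengths weakly decreasing from top to bottom and positive.
`len` is normalized to vanish for `i ≥ r`. -/
structure FerrersShape where
  r : ℕ
  len : ℕ → ℕ
  r_pos : 0 < r
  anti : ∀ i j, i ≤ j → j < r → len j ≤ len i
  len_pos : ∀ i, i < r → 0 < len i
  len_zero : ∀ i, r ≤ i → len i = 0

/-- `(i,j)` is a cell of the diagram `F`. -/
def Cell (F : FerrersShape) (i j : ℕ) : Prop := i < F.r ∧ j < F.len i

/-- An EW-tableau of shape `F`: a 0/1-filling of the cells of `F`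
(`one i j = true` means the cell in row `i`, column `j` holds a 1; `one` is
normalized to be `false` outside the diagram) such that the top row is all 1s,
every other row has at least one 0, and no four cells forming the corners of a
rectangle have 0s in two diagonally opposite corners and 1s in the other two. -/
structure EWTableau (F : FerrersShape) where
  one : ℕ → ℕ → Bool
  support : ∀ i j, one i j = true → Cell F i j
  top_row : ∀ j, j < F.len 0 → one 0 j = true
  has_zero : ∀ i, 0 < i → i < F.r → ∃ j, j < F.len i ∧ one i j = false
  no_rect : ∀ i i' j j', i < i' → i' < F.r → j < j' → j' < F.len i' →
    ¬(one i j = one i' j' ∧ one i j' = one i' j ∧ one i j ≠ one i j')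

/-- An orientation of the Ferrers graph `G(F)`: the vertices are the row labels
`t_i` (`i < r`) and column labels `b_j` (`j < len 0`), with an edge `(t_i, b_j)`
for every cell `(i,j)`; `dir i j = true` means the edge is directed `t_i → b_j`,
`dir i j = false` (for a cell) means it is directed `b_j → t_i`.
`dir` is normalized to be `false` outside the diagram. -/
structure FOrientation (F : FerrersShape) where
  dir : ℕ → ℕ → Bool
  support : ∀ i j, dir i j = true → Cell F i j

/-- The orientation associated to an EW-tableau: the edge `(t_i,b_j)` is directed
`t_i → b_j` exactly when the cell `(i,j)` contains a 0. -/
def EWtoOrient (F : FerrersShape) (T : EWTableau F) : FOrientation F where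
  dir := fun i j => decide (i < F.r) && (decide (j < F.len i) && !(T.one i j))
  support := by
    intro i j h
    simp only [Bool.and_eq_true, decide_eq_true_eq] at h
    exact ⟨h.1, h.2.1⟩

/-- The orientation contains a directed cycle
`t_{q_1} → b_{s_1} → t_{q_2} → b_{s_2} → ⋯ → t_{q_ℓ} → b_{s_ℓ} → t_{q_1}`. -/
def HasDirCycle (F : FerrersShape) (O : FOrientation F) : Prop :=
  ∃ (ℓ : ℕ) (t b : ℕ → ℕ), 2 ≤ ℓ ∧
    (∀ q q', q < ℓ → q' < ℓ → q ≠ q' → t q ≠ t q' ∧ b q ≠ b q') ∧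
    (∀ q, q < ℓ → Cell F (t q) (b q) ∧ O.dir (t q) (b q) = true) ∧
    (∀ q, q < ℓ → Cell F (t ((q + 1) % ℓ)) (b q) ∧ O.dir (t ((q + 1) % ℓ)) (b q) = false)

/-- The vertex `t_0` is a sink of the orientation, and no other vertex
(no other row vertex and no column vertex) is a sink. -/
def UniqueSinkTop (F : FerrersShape) (O : FOrientation F) : Prop :=
  (∀ j, j < F.len 0 → O.dir 0 j = false) ∧
  (∀ i, 0 < i → i < F.r → ∃ j, j < F.len i ∧ O.dir i j = true) ∧
  (∀ j, j < F.len 0 → ∃ i, Cell F i j ∧ O.dir i j = false)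

theorem ew_rect (F : FerrersShape) (T : EWTableau F) (i i' j j' : ℕ) (hi : i ≤ i')
    (hr : i' < F.r) (hj : j < F.len i') (hj' : j' < F.len i')
    (h1 : (EWtoOrient F T).dir i j = true) (h2 : (EWtoOrient F T).dir i' j = false)
    (h3 : (EWtoOrient F T).dir i' j' = true) : (EWtoOrient F T).dir i j' = true := by
  have hl := F.anti i i' hi hr
  have a1 : i < F.r := by omega
  have a2 : j < F.len i := by omega
  have a3 : j' < F.len i := by omega
  simp only [EWtoOrient, a1, a2, a3, hr, hj, hj', decide_true, Bool.true_and,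
    Bool.not_eq_true', Bool.not_eq_false'] at h1 h2 h3 ⊢
  by_contra h
  have h4 : T.one i j' = true := by simpa using h
  have hne : i < i' := by
    rcases Nat.lt_or_eq_of_le hi with h | h
    · exact h
    · subst h; simp_all
  rcases lt_trichotomy j j' with h | h | h
  · exact T.no_rect i i' j j' hne hr h hj' (by simp_all)
  · subst h; simp_all
  · exact T.no_rect i i' j' j hne hr h hj (by simp_all)

theorem ew_acyclic (F : FerrersShape) (T : EWTableau F) : ¬HasDirCycle F (EWtoOrient F T) := by
  rintro ⟨l, t, b, hl, -, hd, hu⟩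
  obtain ⟨p, hp, hmin⟩ := Finset.exists_min_image (Finset.range l) t ⟨0, by simp; omega⟩
  simp only [Finset.mem_range] at hp hmin
  have key : ∀ q, (EWtoOrient F T).dir (t p) (b ((p + q) % l)) = true := by
    intro q
    induction q with
    | zero => simpa [Nat.mod_eq_of_lt hp] using (hd p hp).2
    | succ q ih =>
      have hq : (p + q) % l < l := Nat.mod_lt _ (by omega)
      have hs : ((p + q) % l + 1) % l = (p + (q + 1)) % l := by
        rw [Nat.mod_add_mod]; rfl
      have hq' : (p + (q + 1)) % l < l := Nat.mod_lt _ (by omega)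
      have e := hu _ hq
      rw [hs] at e
      have f := hd _ hq'
      exact ew_rect F T _ _ _ _ (hmin _ hq') f.1.1 e.1.2 f.1.2 ih e.2 f.2
  have h1 := key (l - 1)
  have h2 := (hu ((p + (l - 1)) % l) (Nat.mod_lt _ (by omega))).2
  have hs : ((p + (l - 1)) % l + 1) % l = p := by
    rw [Nat.mod_add_mod, show p + (l - 1) + 1 = p + l by omega, Nat.add_mod_right,
      Nat.mod_eq_of_lt hp]
  rw [hs, h1] at h2
  exact absurd h2 (by simp)

theorem two_cycle (F : FerrersShape) (O : FOrientation F) (i i' j j' : ℕ) (hi : i ≠ i')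
    (hj : j ≠ j') (c1 : Cell F i j) (c2 : Cell F i j') (c3 : Cell F i' j) (c4 : Cell F i' j')
    (h1 : O.dir i j = true) (h2 : O.dir i' j = false) (h3 : O.dir i' j' = true)
    (h4 : O.dir i j' = false) : HasDirCycle F O := by
  refine ⟨2, fun q => if q = 0 then i else i', fun q => if q = 0 then j else j', le_rfl, ?_, ?_, ?_⟩
  · intro q q' hq hq' hne
    interval_cases q <;> interval_cases q' <;> simp_all [Ne.symm]
  · intro q hq
    interval_cases q <;> simp_all
  · intro q hq
    interval_cases q <;> simp_all

/-- the map sending an EW-tableau of shape `F` to the orientation of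
`G(F)` in which the edge `(t_i,b_j)` is directed `t_i → b_j` iff the cell `(i,j)`
contains a 0 is a bijection from EW-tableaux of shape `F` onto acyclic orientations
of `G(F)` whose unique sink is `t_0`. -/
theorem ewTableau_orientation_bijection (F : FerrersShape) :
    Set.BijOn (EWtoOrient F) Set.univ
      {O : FOrientation F | ¬HasDirCycle F O ∧ UniqueSinkTop F O} := by
  refine ⟨?_, ?_, ?_⟩
  · intro T _
    refine ⟨ew_acyclic F T, ?_, ?_, ?_⟩
    · intro j hj
      simp [EWtoOrient, T.top_row j hj]
    · intro i h0 hi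
      obtain ⟨j, hj, h⟩ := T.has_zero i h0 hi
      exact ⟨j, hj, by simp [EWtoOrient, hi, hj, h]⟩
    · intro j hj
      exact ⟨0, ⟨F.r_pos, hj⟩, by simp [EWtoOrient, T.top_row j hj]⟩
  · intro T _ T' _ h
    have hd : ∀ i j, (EWtoOrient F T).dir i j = (EWtoOrient F T').dir i j := by
      intro i j; rw [h]
    have ho : T.one = T'.one := by
      funext i j
      by_cases hc : Cell F i j
      · have := hd i j
        simpa [EWtoOrient, hc.1, hc.2] using this
      · have h1 : T.one i j = false := by
          by_contra h1; exact hc (T.support i j (by simpa using h1))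
        have h2 : T'.one i j = false := by
          by_contra h2; exact hc (T'.support i j (by simpa using h2))
        rw [h1, h2]
    cases T; cases T'; simp only at ho; subst ho; rfl
  · rintro O ⟨hac, h0, hr, -⟩
    let one : ℕ → ℕ → Bool := fun i j =>
      decide (i < F.r) && (decide (j < F.len i) && !(O.dir i j))
    have hone : ∀ i j, Cell F i j → one i j = !(O.dir i j) := by
      intro i j hc; simp [one, hc.1, hc.2]
    refine ⟨⟨one, ?_, ?_, ?_, ?_⟩, trivial, ?_⟩
    · intro i j h
      simp only [one, Bool.and_eq_true, decide_eq_true_eq] at h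
      exact ⟨h.1, h.2.1⟩
    · intro j hj
      rw [hone 0 j ⟨F.r_pos, hj⟩, h0 j hj]; rfl
    · intro i hi hi'
      obtain ⟨j, hj, h⟩ := hr i hi hi'
      exact ⟨j, hj, by rw [hone i j ⟨hi', hj⟩, h]; rfl⟩
    · intro i i' j j' hi hi' hj hj' 
      have hl := F.anti i i' hi.le hi'
      have c1 : Cell F i j := ⟨by omega, by omega⟩
      have c2 : Cell F i j' := ⟨by omega, by omega⟩
      have c3 : Cell F i' j := ⟨by omega, by omega⟩
      have c4 : Cell F i' j' := ⟨by omega, by omega⟩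
      rw [hone _ _ c1, hone _ _ c2, hone _ _ c3, hone _ _ c4]
      rintro ⟨e1, e2, e3⟩
      cases d : O.dir i j
      · exact hac (two_cycle F O i i' j' j hi.ne hj.ne' c2 c1 c4 c3
          (by simp_all) (by simp_all) (by simp_all) (by simp_all))
      · exact hac (two_cycle F O i i' j j' hi.ne hj.ne c1 c2 c3 c4
          (by simp_all) (by simp_all) (by simp_all) (by simp_all))
    · have hd : (fun i j => decide (i < F.r) && (decide (j < F.len i) && !(one i j))) = O.dir := by
        funext i j
        by_cases hc : Cell F i j
        · simp [hone i j hc, hc.1, hc.2]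
        · have h1 : O.dir i j = false := by
            by_contra h1; exact hc (O.support i j (by simpa using h1))
          rw [h1]
          by_contra h2
          simp only [Bool.not_eq_false, Bool.and_eq_true, decide_eq_true_eq] at h2
          exact hc ⟨h2.1, h2.2.1⟩
      have ext : ∀ A B : FOrientation F, A.dir = B.dir → A = B := by
        rintro ⟨a, ha⟩ ⟨b, hb⟩ h
        simp only at h
        subst h
        rfl
      exact ext _ _ hd
end

section
/- For every positive integer n there exists a bijection Θ from the symmetric group S_n to itself such that, for every n-permutation π, the excedance bottoms set of Θ(π) equals the descent bottoms set of π. -/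
/-- An `n`-permutation, encoded as a map `a : ℕ → ℕ` permuting `{1,…,n}`
(normalized to `0` off `{1,…,n}`); `a i` is the letter in place `i`. -/
def IsPermOn (n : ℕ) (a : ℕ → ℕ) : Prop :=
  Set.BijOn a (Set.Icc 1 n) (Set.Icc 1 n) ∧ ∀ i, i ∉ Set.Icc 1 n → a i = 0

/-- The excedance bottoms set of an `n`-permutation: `{i : a_i > i}`. -/
def ExcBottoms (n : ℕ) (a : ℕ → ℕ) : Set ℕ := {i | 1 ≤ i ∧ i ≤ n ∧ i < a i}

/-- The descent bottoms set of an `n`-permutation: `{a_{i+1} : a_i > a_{i+1}}`. -/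
def DescBottoms (n : ℕ) (a : ℕ → ℕ) : Set ℕ :=
  {b | ∃ i, 1 ≤ i ∧ i < n ∧ a (i + 1) < a i ∧ a (i + 1) = b}

theorem isPermOn_iff (n : ℕ) (a : ℕ → ℕ) : IsPermOn n a ↔
    (∀ i, 1 ≤ i → i ≤ n → 1 ≤ a i ∧ a i ≤ n) ∧
    (∀ i j, 1 ≤ i → i ≤ n → 1 ≤ j → j ≤ n → a i = a j → i = j) ∧
    (∀ i, ¬ (1 ≤ i ∧ i ≤ n) → a i = 0) := by
  constructor
  · rintro ⟨⟨h1, h2, -⟩, h4⟩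
    exact ⟨fun i hi hi' => h1 ⟨hi, hi'⟩,
      fun i j hi hi' hj hj' h => h2 ⟨hi, hi'⟩ ⟨hj, hj'⟩ h, fun i hi => h4 i hi⟩
  · rintro ⟨h1, h2, h3⟩
    have hm : Set.MapsTo a (Set.Icc 1 n) (Set.Icc 1 n) := fun i hi => h1 i hi.1 hi.2
    have hi : Set.InjOn a (Set.Icc 1 n) :=
      fun i hi j hj h => h2 i j hi.1 hi.2 hj.1 hj.2 h
    refine ⟨⟨hm, hi, ?_⟩, fun i hi => h3 i hi⟩
    have := Finset.surjOn_of_injOn_of_card_le (s := Finset.Icc 1 n) (t := Finset.Icc 1 n) a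
      (by simpa using hm) (by simpa using hi) le_rfl
    simpa using this

/-- delete the letter in place `p` -/
def delAt (p : ℕ) (a : ℕ → ℕ) : ℕ → ℕ := fun j => if j < p then a j else a (j + 1)

/-- the letter following place `p`, or `n+1` -/
def nextLetter (n p : ℕ) (a : ℕ → ℕ) : ℕ := if p = n + 1 then n + 1 else a (p + 1)

/-- insert `n+1` in place `c`, moving the old letter to place `n+1` -/
def insE (n c : ℕ) (s : ℕ → ℕ) : ℕ → ℕ :=
  fun i => if i = c then n + 1 else if i = n + 1 then s c else s i

theorem exists_pos (n : ℕ) (a : ℕ → ℕ) (ha : IsPermOn (n + 1) a) :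
    ∃ p, 1 ≤ p ∧ p ≤ n + 1 ∧ a p = n + 1 := by
  obtain ⟨p, hp, h⟩ := ha.1.2.2 (show n + 1 ∈ Set.Icc 1 (n + 1) by simp)
  exact ⟨p, hp.1, hp.2, h⟩

theorem delAt_perm (n p : ℕ) (a : ℕ → ℕ) (ha : IsPermOn (n + 1) a) (hp : 1 ≤ p)
    (hp' : p ≤ n + 1) (h : a p = n + 1) : IsPermOn n (delAt p a) := by
  rw [isPermOn_iff] at ha ⊢
  obtain ⟨h1, h2, h3⟩ := ha
  refine ⟨fun i hi hi' => ?_, fun i j hi hi' hj hj' e => ?_, fun i hi => ?_⟩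
  · unfold delAt
    split_ifs with hlt
    · have := h1 i (by omega) (by omega)
      have := h2 i p (by omega) (by omega) hp hp'
      omega
    · have := h1 (i + 1) (by omega) (by omega)
      have := h2 (i + 1) p (by omega) (by omega) hp hp'
      omega
  · unfold delAt at e
    split_ifs at e
    · exact h2 i j (by omega) (by omega) (by omega) (by omega) e
    · have := h2 i (j + 1) (by omega) (by omega) (by omega) (by omega) e
      omega
    · have := h2 (i + 1) j (by omega) (by omega) (by omega) (by omega) e
      omega
    · have := h2 (i + 1) (j + 1) (by omega) (by omega) (by omega) (by omega) e
      omega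
  · unfold delAt
    split_ifs
    · exact h3 _ (by omega)
    · exact h3 _ (by omega)

theorem nextLetter_mem (n p : ℕ) (a : ℕ → ℕ) (ha : IsPermOn (n + 1) a) (hp : 1 ≤ p)
    (hp' : p ≤ n + 1) (h : a p = n + 1) :
    1 ≤ nextLetter n p a ∧ nextLetter n p a ≤ n + 1 ∧
      (nextLetter n p a = n + 1 ↔ p = n + 1) := by
  rw [isPermOn_iff] at ha
  obtain ⟨h1, h2, h3⟩ := ha
  unfold nextLetter
  split_ifs with hpn
  · omega
  · have := h1 (p + 1) (by omega) (by omega)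
    have := h2 (p + 1) p (by omega) (by omega) hp hp'
    omega

theorem desc_step (n p : ℕ) (a : ℕ → ℕ) (ha : IsPermOn (n + 1) a) (hp : 1 ≤ p)
    (hp' : p ≤ n + 1) (h : a p = n + 1) (b : ℕ) :
    b ∈ DescBottoms (n + 1) a ↔
      b ∈ DescBottoms n (delAt p a) ∨ (b = nextLetter n p a ∧ nextLetter n p a ≤ n) := by
  have hc := nextLetter_mem n p a ha hp hp' h
  rw [isPermOn_iff] at ha
  obtain ⟨h1, h2, h3⟩ := ha
  have hnext : p ≤ n → nextLetter n p a = a (p + 1) := fun hh => by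
    unfold nextLetter; rw [if_neg (by omega)]
  constructor
  · rintro ⟨i, hi, hi', hd, rfl⟩
    rcases lt_trichotomy i p with hlt | rfl | hgt
    · rcases Nat.lt_or_ge (i + 1) p with hlt' | hge
      · left
        refine ⟨i, hi, by omega, ?_, ?_⟩ <;> simp [delAt, hlt, hlt', hd]
      · have : i + 1 = p := by omega
        subst this
        have := h1 i (by omega) (by omega)
        omega
    · right
      have := hnext (by omega)
      omega
    · left
      obtain ⟨k, rfl⟩ : ∃ k, i = k + 1 := ⟨i - 1, by omega⟩
      refine ⟨k, by omega, by omega, ?_, ?_⟩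
      · simp only [delAt]
        rw [if_neg (by omega), if_neg (by omega)]
        exact hd
      · simp only [delAt]
        rw [if_neg (by omega)]
  · rintro (⟨i, hi, hi', hd, rfl⟩ | ⟨rfl, hle⟩)
    · rcases lt_trichotomy (i + 1) p with hlt | heq | hgt
      · have e1 : delAt p a i = a i := by simp only [delAt]; rw [if_pos (by omega)]
        have e2 : delAt p a (i + 1) = a (i + 1) := by
          simp only [delAt]; rw [if_pos (by omega)]
        exact ⟨i, hi, by omega, by omega, by omega⟩
      · have e2 : delAt p a (i + 1) = a (p + 1) := by
          simp only [delAt]; rw [if_neg (by omega), heq]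
        have := hnext (by omega)
        exact ⟨p, hp, by omega, by omega, by omega⟩
      · have e1 : delAt p a i = a (i + 1) := by
          simp only [delAt]; rw [if_neg (by omega)]
        have e2 : delAt p a (i + 1) = a (i + 1 + 1) := by
          simp only [delAt]; rw [if_neg (by omega)]
        exact ⟨i + 1, by omega, by omega, by omega, by omega⟩
    · have := hnext (by omega)
      exact ⟨p, hp, by omega, by omega, by omega⟩

theorem insE_perm (n c : ℕ) (s : ℕ → ℕ) (hs : IsPermOn n s) (hc : 1 ≤ c)
    (hc' : c ≤ n + 1) : IsPermOn (n + 1) (insE n c s) := by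
  rw [isPermOn_iff] at hs ⊢
  obtain ⟨h1, h2, h3⟩ := hs
  refine ⟨fun i hi hi' => ?_, fun i j hi hi' hj hj' e => ?_, fun i hi => ?_⟩
  · unfold insE
    split_ifs
    · omega
    · have := h1 c (by omega) (by omega)
      omega
    · have := h1 i (by omega) (by omega)
      omega
  · have k1 := h1 c
    have k2 := h1 i
    have k3 := h1 j
    have k4 := h2 i j
    have k5 := h2 i c
    have k6 := h2 c j
    unfold insE at e
    split_ifs at e <;> omega
  · unfold insE
    rw [if_neg (by omega), if_neg (by omega)]
    exact h3 _ (by omega)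

theorem exc_step (n c : ℕ) (s : ℕ → ℕ) (hs : IsPermOn n s) (hc : 1 ≤ c)
    (hc' : c ≤ n + 1) (b : ℕ) :
    b ∈ ExcBottoms (n + 1) (insE n c s) ↔ b ∈ ExcBottoms n s ∨ (b = c ∧ c ≤ n) := by
  rw [isPermOn_iff] at hs
  obtain ⟨h1, h2, h3⟩ := hs
  have k1 := h1 c
  have k2 := h1 b
  have k3 := h3 b
  simp only [ExcBottoms, Set.mem_setOf_eq, insE]
  split_ifs <;> omega

theorem insE_inj (n c d : ℕ) (s t : ℕ → ℕ) (hs : IsPermOn n s) (ht : IsPermOn n t)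
    (hc : 1 ≤ c) (hc' : c ≤ n + 1) (hd : 1 ≤ d) (hd' : d ≤ n + 1)
    (h : insE n c s = insE n d t) : c = d ∧ s = t := by
  rw [isPermOn_iff] at hs ht
  obtain ⟨h1, h2, h3⟩ := hs
  obtain ⟨g1, g2, g3⟩ := ht
  have hcd : c = d := by
    have e := congrFun h c
    have k1 := g1 d
    have k2 := g1 c
    unfold insE at e
    split_ifs at e <;> omega
  subst hcd
  refine ⟨rfl, funext fun i => ?_⟩
  by_cases hi : 1 ≤ i ∧ i ≤ n
  · have e1 := congrFun h i
    have e2 := congrFun h (n + 1)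
    by_cases hic : i = c
    · subst hic
      unfold insE at e2
      split_ifs at e2 <;> omega
    · unfold insE at e1
      split_ifs at e1 <;> omega
  · rw [h3 i hi, g3 i hi]

theorem del_inj (n p q : ℕ) (a b : ℕ → ℕ) (ha : IsPermOn (n + 1) a)
    (hb : IsPermOn (n + 1) b) (hp : 1 ≤ p) (hp' : p ≤ n + 1) (h : a p = n + 1)
    (hq : 1 ≤ q) (hq' : q ≤ n + 1) (h' : b q = n + 1)
    (e : delAt p a = delAt q b) (ec : nextLetter n p a = nextLetter n q b) : a = b := by
  have k1 := nextLetter_mem n p a ha hp hp' h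
  have k2 := nextLetter_mem n q b hb hq hq' h'
  have hd := delAt_perm n p a ha hp hp' h
  rw [isPermOn_iff] at hd
  have hpq : p = q := by
    by_cases hpn : p = n + 1
    · omega
    · have hqn : q ≠ n + 1 := by omega
      apply hd.2.1 p q (by omega) (by omega) (by omega) (by omega)
      rw [congrFun e q]
      simpa [nextLetter, hpn, hqn, delAt] using ec
  subst hpq
  funext j
  rcases lt_trichotomy j p with hlt | rfl | hgt
  · have := congrFun e j
    simpa [delAt, hlt] using this
  · rw [h, h']
  · obtain ⟨k, rfl⟩ : ∃ k, j = k + 1 := ⟨j - 1, by omega⟩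
    have := congrFun e k
    simp only [delAt] at this
    rwa [if_neg (by omega), if_neg (by omega)] at this

theorem perm_le (n : ℕ) (a : ℕ → ℕ) (ha : IsPermOn n a) (i : ℕ) : a i < n + 1 := by
  rw [isPermOn_iff] at ha
  have k1 := ha.1 i
  have k2 := ha.2.2 i
  omega

theorem perm_finite (n : ℕ) : Finite {a : ℕ → ℕ // IsPermOn n a} := by
  refine Finite.of_injective
    (fun a => (fun i => ⟨a.val i, perm_le n a.val a.prop i⟩ : Fin (n + 1) → Fin (n + 1))) ?_
  intro a b hab
  apply Subtype.ext
  funext i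
  by_cases hi : i < n + 1
  · have := congrFun hab ⟨i, hi⟩
    simpa using this
  · rw [a.prop.2 i (by simp; omega), b.prop.2 i (by simp; omega)]

theorem exists_bij_aux (n : ℕ) :
    ∃ Θ : {a : ℕ → ℕ // IsPermOn n a} → {a : ℕ → ℕ // IsPermOn n a},
      Function.Bijective Θ ∧
      ∀ a : {a : ℕ → ℕ // IsPermOn n a},
        ExcBottoms n (Θ a).val = DescBottoms n a.val := by
  induction n with
  | zero =>
    refine ⟨id, Function.bijective_id, fun a => ?_⟩
    ext b
    simp only [ExcBottoms, DescBottoms, Set.mem_setOf_eq]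
    constructor
    · rintro ⟨_, _, _⟩; omega
    · rintro ⟨_, _, _, _⟩; omega
  | succ n ih =>
    obtain ⟨Θ, hΘ, hE⟩ := ih
    have hpos : ∀ a : {a : ℕ → ℕ // IsPermOn (n + 1) a},
        ∃ p, 1 ≤ p ∧ p ≤ n + 1 ∧ a.val p = n + 1 := fun a => exists_pos n a.val a.prop
    choose p hp hp' h using hpos
    have hc := fun a => nextLetter_mem n (p a) a.val a.prop (hp a) (hp' a) (h a)
    let D : {a : ℕ → ℕ // IsPermOn (n + 1) a} → {a : ℕ → ℕ // IsPermOn n a} :=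
      fun a => ⟨delAt (p a) a.val, delAt_perm n (p a) a.val a.prop (hp a) (hp' a) (h a)⟩
    refine ⟨fun a => ⟨insE n (nextLetter n (p a) a.val) (Θ (D a)).val,
      insE_perm n _ _ (Θ (D a)).prop (hc a).1 (hc a).2.1⟩, ?_, ?_⟩
    · haveI := perm_finite (n + 1)
      refine Function.Injective.bijective_of_finite ?_
      intro a b hab
      obtain ⟨e1, e2⟩ := insE_inj n _ _ _ _ (Θ (D a)).prop (Θ (D b)).prop (hc a).1 (hc a).2.1
        (hc b).1 (hc b).2.1 (congrArg Subtype.val hab)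
      have e3 : D a = D b := hΘ.1 (Subtype.ext e2)
      exact Subtype.ext (del_inj n (p a) (p b) a.val b.val a.prop b.prop (hp a) (hp' a) (h a)
        (hp b) (hp' b) (h b) (congrArg Subtype.val e3) e1)
    · intro a
      ext b
      rw [exc_step n _ _ (Θ (D a)).prop (hc a).1 (hc a).2.1,
        desc_step n (p a) a.val a.prop (hp a) (hp' a) (h a), hE (D a)]

/-- for every `n ≥ 1` there is a bijection `Θ` of the set of
`n`-permutations with itself such that the excedance bottoms set of `Θ(π)`
equals the descent bottoms set of `π`, for every `n`-permutation `π`. -/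
theorem exists_bijection_descBottoms_to_excBottoms (n : ℕ) (hn : 0 < n) :
    ∃ Θ : {a : ℕ → ℕ // IsPermOn n a} → {a : ℕ → ℕ // IsPermOn n a},
      Function.Bijective Θ ∧
      ∀ a : {a : ℕ → ℕ // IsPermOn n a},
        ExcBottoms n (Θ a).val = DescBottoms n a.val := by
  exact exists_bij_aux n
end

section
/- For every Ferrers diagram F, possibly with some empty bottom rows, the number of NEW-tableaux of shape F equals the number of Le-tableaux of shape F. -/
/-- A Ferrers diagram possibly with empty bottom rows: `r` rows; row `i`
(for `i < r`) has `len i` cells, row lengths weakly decreasing, top row nonempty.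
`len` is normalized to vanish for `i ≥ r`. -/
structure FerrersShapeN where
  r : ℕ
  len : ℕ → ℕ
  r_pos : 0 < r
  anti : ∀ i j, i ≤ j → j < r → len j ≤ len i
  len0_pos : 0 < len 0
  len_zero : ∀ i, r ≤ i → len i = 0

/-- A NEW-tableau of shape `F` (`one` normalized to `false` outside the diagram):
every column contains a 1, and no four cells forming the corners of a rectangle
have 0s in two diagonally opposite corners and 1s in the other two. -/
structure NEWTableau (F : FerrersShapeN) where
  one : ℕ → ℕ → Bool
  support : ∀ i j, one i j = true → i < F.r ∧ j < F.len i
  col_has_one : ∀ j, j < F.len 0 → ∃ i, i < F.r ∧ j < F.len i ∧ one i j = true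
  no_rect : ∀ i i' j j', i < i' → i' < F.r → j < j' → j' < F.len i' →
    ¬(one i j = one i' j' ∧ one i j' = one i' j ∧ one i j ≠ one i j')

/-- A Le-tableau of shape `F` (`one` normalized to `false` outside the diagram):
every column contains a 1, and every cell having a 1 above it in its column and a
1 to its left in its row contains a 1. -/
structure LeTableau (F : FerrersShapeN) where
  one : ℕ → ℕ → Bool
  support : ∀ i j, one i j = true → i < F.r ∧ j < F.len i
  col_has_one : ∀ j, j < F.len 0 → ∃ i, i < F.r ∧ j < F.len i ∧ one i j = true
  le_cond : ∀ i j, i < F.r → j < F.len i →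
    (∃ i', i' < i ∧ one i' j = true) → (∃ j', j' < j ∧ one i j' = true) →
    one i j = true

namespace TabPf

/-- NEW-fillings of the columns `j ≥ p`, with column heights `c`. -/
structure NewT (c : ℕ → ℕ) (p : ℕ) (T : ℕ → ℕ → Bool) : Prop where
  supp : ∀ i j, T i j = true → p ≤ j ∧ i < c j
  col : ∀ j, p ≤ j → 0 < c j → ∃ i, T i j = true
  rect : ∀ i i' j j', p ≤ j → j < j' → i < c j' → i' < c j' →
    T i j = true → T i' j = false → T i j' = false → T i' j' = true → False

/-- order preserving labellings of the rows by `0..x-1`. -/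
structure NewPhi (c : ℕ → ℕ) (p h x : ℕ) (T : ℕ → ℕ → Bool) (φ : ℕ → ℕ) : Prop where
  lt : ∀ i, i < h → φ i < x
  zero : ∀ i, h ≤ i → φ i = 0
  mono : ∀ i i' j, p ≤ j → i < c j → i' < c j → T i j = true → T i' j = false → φ i ≤ φ i'

/-- Le-fillings of the columns `j ≥ p`. -/
structure LeT (c : ℕ → ℕ) (p : ℕ) (T : ℕ → ℕ → Bool) : Prop where
  supp : ∀ i j, T i j = true → p ≤ j ∧ i < c j
  col : ∀ j, p ≤ j → 0 < c j → ∃ i, T i j = true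
  le : ∀ i i' j j', i < c j → i' < i → j' < j → T i' j = true → T i j' = true → T i j = true

/-- restricted rows. -/
def Restr (c : ℕ → ℕ) (p : ℕ) (T : ℕ → ℕ → Bool) (i : ℕ) : Prop :=
  ∃ j i', p ≤ j ∧ i < c j ∧ T i j = false ∧ i' < i ∧ T i' j = true

/-- arbitrary labellings of the unrestricted rows by `0..x-1`. -/
structure LePhi (c : ℕ → ℕ) (p h x : ℕ) (T : ℕ → ℕ → Bool) (φ : ℕ → ℕ) : Prop where
  lt : ∀ i, i < h → ¬ Restr c p T i → φ i < x
  zero : ∀ i, h ≤ i → φ i = 0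
  zero' : ∀ i, Restr c p T i → φ i = 0

def NS (c : ℕ → ℕ) (p h x : ℕ) : Set ((ℕ → ℕ → Bool) × (ℕ → ℕ)) :=
  {q | NewT c p q.1 ∧ NewPhi c p h x q.1 q.2}

def LS (c : ℕ → ℕ) (p h x : ℕ) : Set ((ℕ → ℕ → Bool) × (ℕ → ℕ)) :=
  {q | LeT c p q.1 ∧ LePhi c p h x q.1 q.2}

lemma finite_aux (R M h x : ℕ) : {q : (ℕ → ℕ → Bool) × (ℕ → ℕ) |
    (∀ i j, q.1 i j = true → i < R ∧ j < M) ∧ (∀ i, q.2 i ≤ x) ∧ ∀ i, h ≤ i → q.2 i = 0}.Finite := by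
  let g : (ℕ → ℕ → Bool) × (ℕ → ℕ) → (Fin R → Fin M → Bool) × (Fin h → Fin (x+1)) :=
    fun q => (fun i j => q.1 i j, fun i => Fin.ofNat _ (q.2 i))
  apply Set.Finite.of_finite_image (f := g) (Set.toFinite _)
  rintro ⟨T, φ⟩ ⟨h1, h2, h3⟩ ⟨T', φ'⟩ ⟨h1', h2', h3'⟩ he
  simp only [g, Prod.mk.injEq] at he h1 h2 h3 h1' h2' h3' ⊢
  constructor
  · funext i j
    by_cases hij : i < R ∧ j < M
    · exact congrFun (congrFun he.1 ⟨i, hij.1⟩) ⟨j, hij.2⟩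
    · grind
  · funext i
    by_cases hi : i < h
    · have := congrFun he.2 ⟨i, hi⟩
      have := congrArg Fin.val this
      simp only [Fin.ofNat, Nat.mod_eq_of_lt (Nat.lt_succ_of_le (h2 i)),
        Nat.mod_eq_of_lt (Nat.lt_succ_of_le (h2' i))] at this
      exact this
    · grind

lemma NS_finite {c : ℕ → ℕ} (hc : Antitone c) {m : ℕ} (hm : c m = 0) (p h x : ℕ) :
    (NS c p h x).Finite := by
  apply (finite_aux (c 0) m h x).subset
  rintro ⟨T, φ⟩ ⟨h1, h2⟩
  refine ⟨fun i j hij => ?_, fun i => ?_, h2.zero⟩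
  · have := h1.supp i j hij
    have := hc (Nat.zero_le j)
    refine ⟨by omega, ?_⟩
    by_contra hj
    have := hc (not_lt.1 hj)
    omega
  · have := h2.lt i
    have := h2.zero i
    grind

lemma LS_finite {c : ℕ → ℕ} (hc : Antitone c) {m : ℕ} (hm : c m = 0) (p h x : ℕ) :
    (LS c p h x).Finite := by
  apply (finite_aux (c 0) m h x).subset
  rintro ⟨T, φ⟩ ⟨h1, h2⟩
  refine ⟨fun i j hij => ?_, fun i => ?_, h2.zero⟩
  · have := h1.supp i j hij
    have := hc (Nat.zero_le j)
    refine ⟨by omega, ?_⟩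
    by_contra hj
    have := hc (not_lt.1 hj)
    omega
  · have := h2.lt i
    have := h2.zero i
    have := h2.zero' i
    grind

lemma ncard_bij {α β : Type*} {s : Set α} {t : Set β} (f : α → β) (h : Set.BijOn f s t) :
    s.ncard = t.ncard := by
  rw [← h.image_eq, h.injOn.ncard_image]

lemma row_aux (S : ℕ → Set ((ℕ → ℕ → Bool) × (ℕ → ℕ))) (h x : ℕ)
    (hz : ∀ q ∈ S h, q.2 h = 0)
    (h1 : ∀ T φ t, t < x → (T, φ) ∈ S h → (T, Function.update φ h t) ∈ S (h+1))
    (h2 : ∀ T φ, (T, φ) ∈ S (h+1) → φ h < x ∧ (T, Function.update φ h 0) ∈ S h) :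
    (S (h+1)).ncard = x * (S h).ncard := by
  have : (Set.Iio x ×ˢ S h).ncard = x * (S h).ncard := by
    rw [Set.ncard_prod]; simp
  rw [← this]
  symm
  apply ncard_bij (fun q => (q.2.1, Function.update q.2.2 h q.1))
  refine ⟨?_, ?_, ?_⟩
  · rintro ⟨t, T, φ⟩ ⟨ht, hq⟩
    exact h1 _ _ _ ht hq
  · rintro ⟨t, T, φ⟩ ⟨ht, hq⟩ ⟨t', T', φ'⟩ ⟨ht', hq'⟩ he
    have a := hz _ hq
    have b := hz _ hq'
    simp only [Prod.mk.injEq] at he a b ⊢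
    have e := he.2
    refine ⟨by simpa using congrFun e h, he.1, ?_⟩
    funext i
    have := congrFun e i
    by_cases hi : i = h
    · subst hi; rw [a, b]
    · simpa [hi] using this
  · rintro ⟨T, φ⟩ hq
    obtain ⟨a, b⟩ := h2 _ _ hq
    exact ⟨(φ h, T, Function.update φ h 0), ⟨a, b⟩, by simp⟩

lemma NS_row {c : ℕ → ℕ} (hc : Antitone c) (p h x : ℕ) (hh : c p ≤ h) :
    (NS c p (h+1) x).ncard = x * (NS c p h x).ncard := by
  apply row_aux (fun h => NS c p h x)
  · rintro ⟨T, φ⟩ ⟨h1, h2⟩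
    exact h2.zero _ le_rfl
  · rintro T φ t ht ⟨h1, h2⟩
    refine ⟨h1, ?_, ?_, ?_⟩
    · intro i hi; have := h2.lt i; simp only [Function.update_apply]; grind
    · intro i hi; have := h2.zero i; simp only [Function.update_apply]; grind
    · intro i i' j hj hi hi'
      have := hc hj
      have := h2.mono i i' j hj hi hi'; simp only [Function.update_apply]; grind
  · rintro T φ ⟨h1, h2⟩
    refine ⟨h2.lt _ (by omega), h1, ?_, ?_, ?_⟩
    · intro i hi; have := h2.lt i; simp only [Function.update_apply]; grind
    · intro i hi; have := h2.zero i; simp only [Function.update_apply]; grind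
    · intro i i' j hj hi hi'
      have := hc hj
      have := h2.mono i i' j hj hi hi'; simp only [Function.update_apply]; grind

lemma not_restr {c : ℕ → ℕ} (hc : Antitone c) {p h : ℕ} {T} (hh : c p ≤ h) : ¬ Restr c p T h := by
  rintro ⟨j, i', hj, hi, -⟩
  have := hc hj
  omega

lemma LS_row {c : ℕ → ℕ} (hc : Antitone c) (p h x : ℕ) (hh : c p ≤ h) :
    (LS c p (h+1) x).ncard = x * (LS c p h x).ncard := by
  apply row_aux (fun h => LS c p h x)
  · rintro ⟨T, φ⟩ ⟨h1, h2⟩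
    exact h2.zero _ le_rfl
  · rintro T φ t ht ⟨h1, h2⟩
    have hr := not_restr hc (T := T) hh
    refine ⟨h1, ?_, ?_, ?_⟩
    · intro i hi; have := h2.lt i; simp only [Function.update_apply]; grind
    · intro i hi; have := h2.zero i; simp only [Function.update_apply]; grind
    · intro i hi; have := h2.zero' i; simp only [Function.update_apply]; grind
  · rintro T φ ⟨h1, h2⟩
    have hr := not_restr hc (T := T) hh
    refine ⟨h2.lt _ (by omega) hr, h1, ?_, ?_, ?_⟩
    · intro i hi; have := h2.lt i; simp only [Function.update_apply]; grind
    · intro i hi; have := h2.zero i; simp only [Function.update_apply]; grind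
    · intro i hi; have := h2.zero' i; simp only [Function.update_apply]; grind

/-- add column `p`. -/
def ext (p : ℕ) (A : ℕ → Bool) (T : ℕ → ℕ → Bool) : ℕ → ℕ → Bool :=
  fun i j => if j = p then A i else T i j

lemma ext_self (p A T i) : ext p A T i p = A i := by simp [ext]
lemma ext_ne {p A T i j} (h : j ≠ p) : ext p A T i j = T i j := by simp [ext, h]

lemma col_aux {α β : Type*} (S1 : Set β) (S2 S3 : Set α) (x : ℕ) (H : Set (ℕ × α))
    (hf : S3.Finite)
    (f : ℕ × α → β) (hf1 : Set.BijOn f ((Set.Iio x ×ˢ S3) ∩ H) S1)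
    (g : ℕ × α → ℕ × α) (hg : Set.BijOn g (Set.Iio x ×ˢ S2) ((Set.Iio x ×ˢ S3) \ H)) :
    S1.ncard + x * S2.ncard = x * S3.ncard := by
  have e2 : (Set.Iio x ×ˢ S2).ncard = x * S2.ncard := by rw [Set.ncard_prod]; simp
  have e3 : (Set.Iio x ×ˢ S3).ncard = x * S3.ncard := by rw [Set.ncard_prod]; simp
  rw [← e2, ← e3, ← ncard_bij f hf1, ncard_bij g hg]
  exact Set.ncard_inter_add_ncard_sdiff_eq_ncard _ _ ((Set.finite_Iio x).prod hf)

lemma restrict_col (p : ℕ) (T : ℕ → ℕ → Bool) :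
    ext p (fun i => T i p) (ext p (fun _ => false) T) = T := by
  funext i j; by_cases h : j = p <;> simp [ext, h]

lemma ext_inj {p A A' T T'} (h : ext p A T = ext p A' T') (h1 : ∀ i, T i p = T' i p) :
    A = A' ∧ T = T' := by
  constructor
  · funext i; have := congrFun (congrFun h i) p; simpa [ext] using this
  · funext i j; have := congrFun (congrFun h i) j
    by_cases hj : j = p
    · subst hj; exact h1 i
    · simpa [ext, hj] using this

lemma NewT_ext {c : ℕ → ℕ} (hc : Antitone c) {p : ℕ} {A T} (hT : ∀ i, T i p = false) :
    NewT c p (ext p A T) ↔ NewT c (p+1) T ∧ (∀ i, A i = true → i < c p) ∧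
      (0 < c p → ∃ i, A i = true) ∧ ∀ i i' j', p < j' → i < c j' → i' < c j' →
        A i = true → A i' = false → T i j' = false → T i' j' = true → False := by
  constructor
  · rintro ⟨h1, h2, h3⟩
    refine ⟨⟨?_, ?_, ?_⟩, ?_, ?_, ?_⟩
    · intro i j h
      have := h1 i j; simp only [ext] at this
      grind
    · intro j hj hj'
      have := h2 j (by omega) hj'
      simpa [ext, show j ≠ p by omega] using this
    · intro i i' j j' hj hjj
      have := h3 i i' j j' (by omega) hjj
      simpa only [ext, show j ≠ p by omega, show j' ≠ p by omega, if_false] using this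
    · intro i hi
      have := h1 i p; simp only [ext] at this; grind
    · intro h; have := h2 p le_rfl h; simpa [ext] using this
    · intro i i' j' hj
      have := h3 i i' p j' le_rfl hj
      simpa only [ext, show j' ≠ p by omega, if_false, if_true] using this
  · rintro ⟨⟨h1, h2, h3⟩, h4, h5, h6⟩
    refine ⟨?_, ?_, ?_⟩
    · intro i j h
      simp only [ext] at h
      have := h1 i j
      grind
    · intro j hj hj'
      by_cases h : j = p
      · subst h; simpa [ext] using h5 hj'
      · simpa [ext, h] using h2 j (by omega) hj'
    · intro i i' j j' hj hjj
      by_cases h : j = p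
      · subst h
        have := h6 i i' j' hjj
        simpa only [ext, show j' ≠ j by omega, if_false, if_true] using this
      · simpa only [ext, show j ≠ p by omega, show j' ≠ p by omega, if_false] using
          h3 i i' j j' (by omega) hjj

lemma mono_ext {c : ℕ → ℕ} {p : ℕ} {A T} {φ : ℕ → ℕ} :
    (∀ i i' j, p ≤ j → i < c j → i' < c j → ext p A T i j = true → ext p A T i' j = false →
      φ i ≤ φ i') ↔
    (∀ i i' j, p + 1 ≤ j → i < c j → i' < c j → T i j = true → T i' j = false →
      φ i ≤ φ i') ∧ ∀ i i', i < c p → i' < c p → A i = true → A i' = false → φ i ≤ φ i' := by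
  constructor
  · intro h
    constructor
    · intro i i' j hj
      have := h i i' j (by omega)
      simpa only [ext, show j ≠ p by omega, if_false] using this
    · intro i i'
      have := h i i' p le_rfl
      simpa only [ext, if_true] using this
  · rintro ⟨h, h'⟩ i i' j hj
    by_cases e : j = p
    · subst e; simpa only [ext, if_true] using h' i i'
    · simpa only [ext, e, if_false] using h i i' j (by omega)

lemma NS_col {c : ℕ → ℕ} (hc : Antitone c) {m : ℕ} (hm : c m = 0) (p x : ℕ) (hp : 0 < c p) :
    (NS c p (c p) x).ncard + x * (NS c (p+1) (c p) x).ncard =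
      x * (NS c (p+1) (c p) (x+1)).ncard := by
  have hle : ∀ j, p < j → c j ≤ c p := fun j hj => hc hj.le
  have hz : ∀ {T}, NewT c (p+1) T → ∀ i, T i p = false := by
    intro T h i
    have := h.supp i p
    by_contra h; simp at h; have := this h; omega
  refine col_aux _ _ _ x {q | ∃ i, i < c p ∧ q.2.2 i = q.1} (NS_finite hc hm _ _ _)
    (fun q => (ext p (fun i => decide (i < c p ∧ q.2.2 i ≤ q.1)) q.2.1,
      fun i => if q.2.2 i ≤ q.1 then q.2.2 i else q.2.2 i - 1)) ⟨?_, ?_, ?_⟩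
    (fun q => (q.1, q.2.1, fun i => if i < c p then (if q.2.2 i < q.1 then q.2.2 i else q.2.2 i + 1) else 0))
    ⟨?_, ?_, ?_⟩
  · rintro ⟨t, T, ψ⟩ ⟨⟨ht, h1, h2⟩, i0, hi0, hi0'⟩
    simp only [Set.mem_Iio] at ht h1 h2 hi0'
    refine ⟨(NewT_ext hc (hz h1)).2 ⟨h1, ?_, ?_, ?_⟩, ⟨?_, ?_, ?_⟩⟩
    · grind
    · intro _; exact ⟨i0, by simp; omega⟩
    · intro i i' j' hj hi hi' ha ha' hT hT'
      have := h2.mono i' i j' hj hi' hi hT' hT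
      have := hle j' hj
      simp at ha ha'
      omega
    · intro i hi
      have := h2.lt i hi
      grind
    · intro i hi
      have := h2.zero i hi
      grind
    · rw [mono_ext]
      constructor
      · intro i i' j hj hi hi' ha ha'
        have := h2.mono i i' j hj hi hi' ha ha'
        grind
      · grind
  · rintro ⟨t, T, ψ⟩ ⟨⟨ht, h1, h2⟩, i0, hi0, hi0'⟩ ⟨t', T', ψ'⟩ ⟨⟨ht', h1', h2'⟩, i0', hi0', hi0''⟩ he
    simp only [Set.mem_Iio, Prod.mk.injEq] at *
    obtain ⟨e1, e2⟩ := he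
    obtain ⟨e1, e3⟩ := ext_inj e1 (by simp [hz h1, hz h1'])
    have e1 : ∀ i, i < c p → (ψ i ≤ t ↔ ψ' i ≤ t') := by
      intro i hi
      have := congrFun e1 i
      simpa [hi] using this
    have e2 := fun i => congrFun e2 i
    beta_reduce at e2
    have ett : t = t' := by
      have a := e1 i0 hi0
      have b := e1 i0' hi0'
      have a' := e2 i0
      have b' := e2 i0'
      grind
    subst ett
    refine ⟨rfl, e3, ?_⟩
    funext i
    by_cases hi : i < c p
    · have := e1 i hi
      have := e2 i
      grind
    · rw [h2.zero i (by omega), h2'.zero i (by omega)]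
  · rintro ⟨T, φ⟩ ⟨h1, h2⟩
    obtain ⟨A, T0, rfl, hT0⟩ : ∃ A T0, T = ext p A T0 ∧ ∀ i, T0 i p = false :=
      ⟨_, _, (restrict_col p T).symm, by simp [ext]⟩
    obtain ⟨h1, hA1, hA2, hA3⟩ := (NewT_ext hc hT0).1 h1
    obtain ⟨h2, h3, h4⟩ := h2
    rw [mono_ext] at h4
    simp only at h1 h2 h3 h4
    obtain ⟨k, hk, hmax⟩ : ∃ k, A k = true ∧ ∀ i, A i = true → φ i ≤ φ k := by
      have : ((Finset.range (c p)).filter (fun i => A i = true)).Nonempty := by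
        obtain ⟨i, hi⟩ := hA2 hp
        exact ⟨i, by simp [hi, hA1 i hi]⟩
      obtain ⟨k, hk, hk'⟩ := Finset.exists_max_image _ φ this
      simp at hk hk'
      exact ⟨k, hk.2, fun i hi => hk' i (hA1 i hi) hi⟩
    have hkc := hA1 k hk
    refine ⟨(φ k, T0, fun i => if i < c p then (if A i then φ i else φ i + 1) else 0),
      ⟨⟨h2 k hkc, h1, ?_, ?_, ?_⟩, k, hkc, ?_⟩, ?_⟩
    · intro i hi; have := h2 i hi; grind
    · grind
    · intro i i' j hj hi hi' ha ha'
      have := h4.1 i i' j hj hi hi' ha ha'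
      have := hA3 i' i j hj hi' hi
      have := hle j hj
      grind
    · simp [hk, hkc]
    · simp only [Prod.mk.injEq]
      constructor
      · congr 1
        funext i
        by_cases hi : i < c p
        · have := h4.2 k i hkc hi hk
          have := hmax i
          rw [Bool.eq_iff_iff, decide_eq_true_eq]
          by_cases hAi : A i = true <;> grind
        · have := hA1 i
          rw [Bool.eq_iff_iff, decide_eq_true_eq]
          grind
      · funext i
        have := h4.2 k i hkc
        have := hmax i
        have := h3 i
        cases hAi : A i <;> grind
  · rintro ⟨t, T, φ⟩ ⟨ht, h1, h2⟩
    simp only [Set.mem_Iio] at ht h1 h2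
    refine ⟨⟨ht, h1, ?_, ?_, ?_⟩, ?_⟩
    · intro i hi; have := h2.lt i hi; grind
    · grind
    · intro i i' j hj hi hi' ha ha'
      have := h2.mono i i' j hj hi hi' ha ha'
      have := hle j hj
      grind
    · simp only [Set.mem_ofPred_eq, not_exists]; grind
  · rintro ⟨t, T, φ⟩ ⟨ht, h1, h2⟩ ⟨t', T', φ'⟩ ⟨ht', h1', h2'⟩ he
    simp only [Set.mem_Iio, Prod.mk.injEq] at *
    obtain ⟨rfl, rfl, e⟩ := he
    refine ⟨rfl, rfl, ?_⟩
    funext i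
    have := congrFun e i
    have := h2.zero i
    have := h2'.zero i
    grind
  · rintro ⟨t, T, ψ⟩ ⟨⟨ht, h1, h2⟩, hn⟩
    simp only [Set.mem_Iio, Set.mem_ofPred_eq, not_exists, not_and] at ht h1 h2 hn
    refine ⟨(t, T, fun i => if ψ i < t then ψ i else ψ i - 1), ⟨ht, h1, ?_, ?_, ?_⟩, ?_⟩
    · intro i hi; have := h2.lt i hi; have := hn i hi; grind
    · intro i hi; have := h2.zero i hi; grind
    · intro i i' j hj hi hi' ha ha'
      have := h2.mono i i' j hj hi hi' ha ha'
      grind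
    · simp only [Prod.mk.injEq, true_and]
      funext i
      have := h2.zero i
      have := hn i
      grind

lemma LeT_ext {c : ℕ → ℕ} (hc : Antitone c) {p : ℕ} {A T} (hT : ∀ i, T i p = false) :
    LeT c p (ext p A T) ↔ LeT c (p+1) T ∧ (∀ i, A i = true → i < c p) ∧
      (0 < c p → ∃ i, A i = true) ∧ ∀ i, A i = true → ¬ Restr c (p+1) T i := by
  constructor
  · rintro ⟨h1, h2, h3⟩
    refine ⟨⟨?_, ?_, ?_⟩, ?_, ?_, ?_⟩
    · intro i j h
      have := h1 i j; simp only [ext] at this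
      grind
    · intro j hj hj'
      have := h2 j (by omega) hj'
      simpa [ext, show j ≠ p by omega] using this
    · intro i i' j j' hi hi' hjj ha hb
      have := h3 i i' j j' hi hi' hjj
      simp only [ext] at this
      grind
    · intro i hi
      have := h1 i p; simp only [ext] at this; grind
    · intro h; have := h2 p le_rfl h; simpa [ext] using this
    · rintro i hi ⟨j, i', hj, hij, hf, hi', ht⟩
      have := h3 i i' j p hij hi' (by omega)
      simp only [ext] at this
      grind
  · rintro ⟨⟨h1, h2, h3⟩, h4, h5, h6⟩
    refine ⟨?_, ?_, ?_⟩
    · intro i j h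
      simp only [ext] at h
      have := h1 i j
      grind
    · intro j hj hj'
      by_cases h : j = p
      · subst h; simpa [ext] using h5 hj'
      · simpa [ext, h] using h2 j (by omega) hj'
    · intro i i' j j' hi hi' hjj ha hb
      simp only [ext] at ha hb ⊢
      have a1 := h1 i j'
      have a3 := h3 i i' j j' hi hi' hjj
      by_cases hj' : j' = p
      · have hjp : j ≠ p := by omega
        simp only [hjp, hj', if_true, if_false] at *
        by_contra hh
        exact h6 i hb ⟨j, i', by omega, hi, by simpa using hh, hi', ha⟩
      · grind

lemma Restr_ext {c : ℕ → ℕ} {p : ℕ} {A T} {i : ℕ} :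
    Restr c p (ext p A T) i ↔ Restr c (p+1) T i ∨
      (i < c p ∧ A i = false ∧ ∃ i', i' < i ∧ A i' = true) := by
  constructor
  · rintro ⟨j, i', hj, hij, hf, hi', ht⟩
    by_cases h : j = p
    · subst h; right; simp only [ext, if_true] at hf ht; exact ⟨hij, hf, i', hi', ht⟩
    · left; simp only [ext, h, if_false] at hf ht; exact ⟨j, i', by omega, hij, hf, hi', ht⟩
  · rintro (⟨j, i', hj, hij, hf, hi', ht⟩ | ⟨hij, hf, i', hi', ht⟩)
    · have : j ≠ p := by omega
      exact ⟨j, i', by omega, hij, by simpa [ext, this] using hf, hi', by simpa [ext, this] using ht⟩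
    · exact ⟨p, i', le_rfl, hij, by simpa [ext] using hf, hi', by simpa [ext] using ht⟩

lemma exists_first {P : ℕ → Prop} (h : ∃ i, P i) : ∃ k, P k ∧ ∀ i, i < k → ¬ P i := by
  classical
  exact ⟨Nat.find h, Nat.find_spec h, fun i hi => Nat.find_min h hi⟩

open Classical in
/-- inverse of the Le column step. -/
noncomputable def leCol (c : ℕ → ℕ) (p x : ℕ) (q : ℕ × ((ℕ → ℕ → Bool) × (ℕ → ℕ))) :
    (ℕ → ℕ → Bool) × (ℕ → ℕ) :=
  (ext p (fun i => decide (i < c p ∧ ¬ Restr c (p+1) q.2.1 i ∧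
      ((q.2.2 i = x ∧ ∀ i', i' < i → q.2.2 i' ≠ x) ∨ (q.2.2 i ≠ x ∧ ∃ i', i' < i ∧ q.2.2 i' = x))))
      q.2.1,
    fun i => if q.2.2 i = x then (if ∃ i', i' < i ∧ q.2.2 i' = x then 0 else q.1) else q.2.2 i)

lemma LS_col {c : ℕ → ℕ} (hc : Antitone c) {m : ℕ} (hm : c m = 0) (p x : ℕ) (hp : 0 < c p)
    (hx : 0 < x) :
    (LS c p (c p) x).ncard + x * (LS c (p+1) (c p) x).ncard =
      x * (LS c (p+1) (c p) (x+1)).ncard := by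
  classical
  have hz : ∀ {T}, LeT c (p+1) T → ∀ i, T i p = false := by
    intro T h i
    have := h.supp i p
    by_contra h; simp at h; have := this h; omega
  have hU : ∀ {T ψ}, LePhi c (p+1) (c p) (x+1) T ψ → ∀ i, ψ i = x →
      i < c p ∧ ¬ Restr c (p+1) T i := by
    intro T ψ h i hi
    constructor
    · by_contra hh; have := h.zero i (by omega); omega
    · intro hh; have := h.zero' i hh; omega
  refine col_aux _ _ _ x {q | ∃ i, q.2.2 i = x} (LS_finite hc hm _ _ _)
    (leCol c p x) ⟨?_, ?_, ?_⟩ id ⟨?_, ?_, ?_⟩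
  · rintro ⟨t, T, ψ⟩ ⟨⟨ht, h1, h2⟩, hi0⟩
    simp only [Set.mem_Iio, Set.mem_ofPred_eq] at ht h1 h2 hi0
    obtain ⟨k, hk, hkm⟩ := exists_first hi0
    have hkU := hU h2 k hk
    refine ⟨(LeT_ext hc (hz h1)).2 ⟨h1, ?_, ?_, ?_⟩, ⟨?_, ?_, ?_⟩⟩
    · intro i hi; simp only [decide_eq_true_eq] at hi; exact hi.1
    · intro _; exact ⟨k, by simp only [decide_eq_true_eq]; exact ⟨hkU.1, hkU.2, Or.inl ⟨hk, hkm⟩⟩⟩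
    · intro i hi; simp only [decide_eq_true_eq] at hi; exact hi.2.1
    · intro i hi hR
      simp only [leCol, Restr_ext, not_or] at hR ⊢
      have := h2.lt i hi hR.1
      grind
    · intro i hi
      have := h2.zero i hi
      simp only [leCol]
      grind
    · intro i hR
      simp only [leCol, Restr_ext] at hR ⊢
      rcases hR with hR | ⟨hi, hA, i', hi', hA'⟩
      · have := h2.zero' i hR
        grind
      · simp only [decide_eq_true_eq, decide_eq_false_iff_not] at hA hA'
        have hzz := h2.zero' i
        have hE : ∃ i', i' < i ∧ ψ i' = x := by
          rcases hA'.2.2 with hh | ⟨_, i2, hi2, hh⟩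
          · exact ⟨i', hi', hh.1⟩
          · exact ⟨i2, by omega, hh⟩
        rw [if_pos hE]
        by_cases hR : Restr c (p+1) T i
        · rw [hzz hR]; simp
        · by_cases hix : ψ i = x
          · simp [hix]
          · exact absurd ⟨hi, hR, Or.inr ⟨hix, hE⟩⟩ hA
  · rintro ⟨t, T, ψ⟩ ⟨⟨ht, h1, h2⟩, hi0⟩ ⟨t', T', ψ'⟩ ⟨⟨ht', h1', h2'⟩, hi0'⟩ he
    simp only [Set.mem_Iio, Prod.mk.injEq, leCol, Set.mem_ofPred_eq] at *
    obtain ⟨e1, e2⟩ := he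
    obtain ⟨e1, rfl⟩ := ext_inj e1 (by simp [hz h1, hz h1'])
    have f1 := fun i => congrFun e1 i
    simp only [decide_eq_decide] at f1
    have f2 := fun i => congrFun e2 i
    beta_reduce at f2
    obtain ⟨k, hk, hkm⟩ := exists_first hi0
    obtain ⟨k', hk', hkm'⟩ := exists_first hi0'
    have hkU := hU h2 k hk
    have hkU' := hU h2' k' hk'
    have ek : k = k' := by
      have a := f1 k
      have b := f1 k'
      rcases lt_trichotomy k k' with h | h | h
      · grind
      · exact h
      · grind
    subst ek
    have ett : t = t' := by
      have a' := f2 k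
      grind
    subst ett
    refine ⟨rfl, rfl, ?_⟩
    funext i
    have a := f1 i
    have b := f2 i
    by_cases hi : i < c p ∧ ¬ Restr c (p+1) T i
    · rcases lt_trichotomy i k with h | h | h
      · grind
      · grind
      · grind
    · have := h2.zero i
      have := h2'.zero i
      have := h2.zero' i
      have := h2'.zero' i
      grind
  · rintro ⟨T, φ⟩ ⟨h1, h2⟩
    obtain ⟨A, T0, rfl, hT0⟩ : ∃ A T0, T = ext p A T0 ∧ ∀ i, T0 i p = false :=
      ⟨_, _, (restrict_col p T).symm, by simp [ext]⟩
    obtain ⟨h1, hA1, hA2, hA3⟩ := (LeT_ext hc hT0).1 h1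
    obtain ⟨h2, h3, h4⟩ := h2
    simp only [Restr_ext] at h1 h2 h3 h4
    obtain ⟨k, hk, hkm⟩ := exists_first (hA2 hp)
    have hkc := hA1 k hk
    have hkR := hA3 k hk
    have hkx : φ k < x := h2 k hkc (by grind)
    refine ⟨(φ k, T0, fun i => if i < c p ∧ ¬ Restr c (p+1) T0 i then
        (if i < k then φ i else if i = k then x else if A i then φ i else x) else 0),
      ⟨⟨hkx, h1, ?_, ?_, ?_⟩, k, ?_⟩, ?_⟩
    · intro i hi hR; have := h2 i hi; grind
    · grind
    · grind
    · simp [hkc, hkR]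
    · have key : ∀ i, i < c p → ¬ Restr c (p+1) T0 i → (i < k ∨ A i = true) → φ i < x := by
        intro i hi hR hh
        apply h2 i hi
        grind
      have hex : ∀ i, (∃ i', i' < i ∧ (if i' < c p ∧ ¬ Restr c (p+1) T0 i' then
        (if i' < k then φ i' else if i' = k then x else if A i' then φ i' else x) else 0) = x) ↔
          k < i := by
        intro i
        constructor
        · rintro ⟨i', hi', he⟩
          have := key i'
          grind
        · intro hh; exact ⟨k, hh, by simp [hkc, hkR]⟩
      have hall : ∀ i, (∀ i', i' < i → (if i' < c p ∧ ¬ Restr c (p+1) T0 i' then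
        (if i' < k then φ i' else if i' = k then x else if A i' then φ i' else x) else 0) ≠ x) ↔
          ¬ k < i := by
        intro i; rw [← hex i]; push Not; rfl
      simp only [leCol, Prod.mk.injEq, hex, hall]
      constructor
      · congr 1
        funext i
        have := key i
        have := hA1 i
        have := hA3 i
        have := hkm i
        rw [Bool.eq_iff_iff, decide_eq_true_eq]
        rcases lt_trichotomy i k with h | h | h
        · grind
        · grind
        · grind
      · funext i
        have := key i
        have := h3 i
        have := h4 i
        rcases lt_trichotomy i k with h | h | h
        · grind
        · grind
        · have := hkm i
          grind
  · rintro ⟨t, T, φ⟩ ⟨ht, h1, h2⟩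
    simp only [Set.mem_Iio] at ht h1 h2
    refine ⟨⟨ht, h1, ?_, h2.zero, h2.zero'⟩, ?_⟩
    · intro i hi hR; have := h2.lt i hi hR; simp only [id]; omega
    · simp only [Set.mem_ofPred_eq, not_exists, id]
      intro i
      have := h2.lt i
      have := h2.zero i
      have := h2.zero' i
      grind
  · exact Function.injective_id.injOn
  · rintro ⟨t, T, ψ⟩ ⟨⟨ht, h1, h2⟩, hn⟩
    simp only [Set.mem_ofPred_eq, not_exists] at ht h1 h2 hn
    refine ⟨(t, T, ψ), ⟨ht, h1, ?_, h2.zero, h2.zero'⟩, rfl⟩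
    intro i hi hR; have := h2.lt i hi hR; have := hn i; simp only at *; omega

lemma rows {c : ℕ → ℕ} (hc : Antitone c) (p x : ℕ)
    (h : (NS c p (c p) x).ncard = (LS c p (c p) x).ncard) (k : ℕ) (hk : c p ≤ k) :
    (NS c p k x).ncard = (LS c p k x).ncard := by
  induction k, hk using Nat.le_induction with
  | base => exact h
  | succ k hk ih => rw [NS_row hc p k x hk, LS_row hc p k x hk, ih]

lemma base {c : ℕ → ℕ} (hc : Antitone c) {m : ℕ} (hm : c m = 0) (x : ℕ) :
    NS c m (c m) x = LS c m (c m) x := by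
  have hcj : ∀ j, m ≤ j → c j = 0 := fun j hj => by have := hc hj; omega
  ext ⟨T, φ⟩
  constructor
  · rintro ⟨h1, h2⟩
    have hT : ∀ i j, T i j = false := by
      intro i j; by_contra h; simp at h; have := h1.supp i j h; have := hcj j; omega
    refine ⟨⟨h1.supp, h1.col, ?_⟩, ⟨fun i hi => by omega, h2.zero, ?_⟩⟩
    · intro i i' j j' _ _ _ h; simp [hT] at h
    · rintro i ⟨j, i', _, _, _, _, h⟩; simp [hT] at h
  · rintro ⟨h1, h2⟩
    have hT : ∀ i j, T i j = false := by
      intro i j; by_contra h; simp at h; have := h1.supp i j h; have := hcj j; omega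
    refine ⟨⟨h1.supp, h1.col, ?_⟩, ⟨fun i hi => by omega, h2.zero, ?_⟩⟩
    · intro i i' j j' _ _ _ _ h; simp [hT] at h
    · intro i i' j  _ _ _ h; simp [hT] at h

lemma main {c : ℕ → ℕ} (hc : Antitone c) {m : ℕ} (hm : c m = 0) (hpos : ∀ j, j < m → 0 < c j)
    (d p : ℕ) (hd : p + d = m) (x : ℕ) (hx : 0 < x) (k : ℕ) (hk : c p ≤ k) :
    (NS c p k x).ncard = (LS c p k x).ncard := by
  induction d generalizing p x k with
  | zero =>
    obtain rfl : p = m := by omega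
    exact rows hc p x (by rw [base hc hm]) k hk
  | succ d ih =>
    refine rows hc p x ?_ k hk
    have a := NS_col hc hm p x (hpos p (by omega))
    have b := LS_col hc hm p x (hpos p (by omega)) hx
    have hcp : c (p+1) ≤ c p := hc (by omega)
    rw [ih (p+1) (by omega) x hx _ hcp, ih (p+1) (by omega) (x+1) (by omega) _ hcp, ← b] at a
    omega

/-- height of column `j`. -/
def ht (F : FerrersShapeN) (j : ℕ) : ℕ := ((Finset.range F.r).filter (fun i => j < F.len i)).card

lemma lt_ht (F : FerrersShapeN) (i j : ℕ) : i < ht F j ↔ i < F.r ∧ j < F.len i := by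
  constructor
  · intro h
    by_contra hn
    have : (Finset.range F.r).filter (fun i => j < F.len i) ⊆ Finset.range i := by
      intro k hk
      simp only [Finset.mem_filter, Finset.mem_range] at hk ⊢
      by_contra hki
      have := F.anti i k (by omega) hk.1
      omega
    have := Finset.card_le_card this
    simp only [Finset.card_range] at this
    unfold ht at h
    omega
  · rintro ⟨h1, h2⟩
    have : Finset.range (i+1) ⊆ (Finset.range F.r).filter (fun i => j < F.len i) := by
      intro k hk
      simp only [Finset.mem_filter, Finset.mem_range] at hk ⊢
      have := F.anti k i (by omega) h1
      omega
    have := Finset.card_le_card this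
    simp only [Finset.card_range] at this
    unfold ht
    omega

lemma ht_anti (F : FerrersShapeN) : Antitone (ht F) := by
  intro a b hab
  apply le_of_forall_lt
  intro i hi
  rw [lt_ht] at hi ⊢
  omega

lemma ht_pos (F : FerrersShapeN) (j : ℕ) : 0 < ht F j ↔ j < F.len 0 := by
  rw [lt_ht]; have := F.r_pos; simp [this]

lemma new_card (F : FerrersShapeN) :
    Nat.card (NEWTableau F) = (NS (ht F) 0 (ht F 0) 1).ncard := by
  rw [← Nat.card_coe_set_eq]
  apply Nat.card_congr
  refine ⟨fun t => ⟨(t.one, fun _ => 0), ⟨?_, ?_, ?_⟩, ⟨by simp, by simp, by simp⟩⟩,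
    fun q => ⟨q.1.1, ?_, ?_, ?_⟩, fun t => rfl, ?_⟩
  · intro i j h; exact ⟨Nat.zero_le _, (lt_ht F i j).2 (t.support i j h)⟩
  · intro j _ hj
    obtain ⟨i, _, _, h⟩ := t.col_has_one j ((ht_pos F j).1 hj)
    exact ⟨i, h⟩
  · intro i i' j j' _ hjj hi hi' a b d e
    rw [lt_ht] at hi hi'
    simp only at a b d e
    rcases lt_trichotomy i i' with h | h | h
    · exact t.no_rect i i' j j' h hi'.1 hjj hi'.2 (by simp [a, b, d, e])
    · subst h; simp [a] at b
    · exact t.no_rect i' i j j' h hi.1 hjj hi.2 (by simp [a, b, d, e])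
  · intro i j h; exact (lt_ht F i j).1 (q.2.1.supp i j h).2
  · intro j hj
    obtain ⟨i, h⟩ := q.2.1.col j (Nat.zero_le _) ((ht_pos F j).2 hj)
    have := (lt_ht F i j).1 (q.2.1.supp i j h).2
    exact ⟨i, this.1, this.2, h⟩
  · rintro i i' j j' hii hi' hjj hj' ⟨a, b, d⟩
    have h1 := (lt_ht F i' j').2 ⟨hi', hj'⟩
    have r1 := q.2.1.rect i i' j j' (Nat.zero_le _) hjj (by omega) h1
    have r2 := q.2.1.rect i' i j j' (Nat.zero_le _) hjj h1 (by omega)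
    revert a b d r1 r2
    cases q.1.1 i j <;> cases q.1.1 i' j <;> cases q.1.1 i j' <;> cases q.1.1 i' j' <;> simp
  · rintro ⟨⟨T, φ⟩, h1, h2⟩
    have : φ = fun _ => 0 := by
      funext i
      have := h2.lt i
      have := h2.zero i
      grind
    subst this
    rfl

lemma le_card (F : FerrersShapeN) :
    Nat.card (LeTableau F) = (LS (ht F) 0 (ht F 0) 1).ncard := by
  rw [← Nat.card_coe_set_eq]
  apply Nat.card_congr
  refine ⟨fun t => ⟨(t.one, fun _ => 0), ⟨?_, ?_, ?_⟩, ⟨by simp, by simp, by simp⟩⟩,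
    fun q => ⟨q.1.1, ?_, ?_, ?_⟩, fun t => rfl, ?_⟩
  · intro i j h; exact ⟨Nat.zero_le _, (lt_ht F i j).2 (t.support i j h)⟩
  · intro j _ hj
    obtain ⟨i, _, _, h⟩ := t.col_has_one j ((ht_pos F j).1 hj)
    exact ⟨i, h⟩
  · intro i i' j j' hi hi' hjj a b
    rw [lt_ht] at hi
    exact t.le_cond i j hi.1 hi.2 ⟨i', hi', a⟩ ⟨j', hjj, b⟩
  · intro i j h; exact (lt_ht F i j).1 (q.2.1.supp i j h).2
  · intro j hj
    obtain ⟨i, h⟩ := q.2.1.col j (Nat.zero_le _) ((ht_pos F j).2 hj)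
    have := (lt_ht F i j).1 (q.2.1.supp i j h).2
    exact ⟨i, this.1, this.2, h⟩
  · rintro i j hi hj ⟨i', hi', a⟩ ⟨j', hj', b⟩
    exact q.2.1.le i i' j j' ((lt_ht F i j).2 ⟨hi, hj⟩) hi' hj' a b
  · rintro ⟨⟨T, φ⟩, h1, h2⟩
    have : φ = fun _ => 0 := by
      funext i
      have := h2.lt i
      have := h2.zero i
      have := h2.zero' i
      grind
    subst this
    rfl

end TabPf

/-- for every Ferrers diagram `F` (possibly with empty bottom rows),
the number of NEW-tableaux of shape `F` equals the number of Le-tableaux of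
shape `F`. -/
theorem newTableaux_card_eq_leTableaux_card (F : FerrersShapeN) :
    Nat.card (NEWTableau F) = Nat.card (LeTableau F) := by
  rw [TabPf.new_card, TabPf.le_card]
  have hm : TabPf.ht F (F.len 0) = 0 := by
    have := TabPf.ht_pos F (F.len 0)
    omega
  exact TabPf.main (TabPf.ht_anti F) hm (fun j hj => (TabPf.ht_pos F j).2 hj)
    (F.len 0) 0 (by omega) 1 one_pos _ le_rfl
end

section
/- For all positive integers n and all k ≥ 0, the number of n-permutations a_1...a_n with exactly k fixed points different from 1 (indices i ≥ 2 with a_i = i) equals the number of n-permutations with exactly k decreasing adjacencies. -/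
namespace FPDA

/-- fixed points other than the first one -/
def fixS {n : ℕ} (σ : Equiv.Perm (Fin n)) : Finset ℕ :=
  (Finset.range n).filter (fun i => 0 < i ∧ ∃ h : i < n, (σ ⟨i, h⟩).val = i)

/-- values `x` immediately followed by `x - 1`, where `b x` is the position of `x` -/
def adjS {n : ℕ} (b : Equiv.Perm (Fin n)) : Finset ℕ :=
  (Finset.range n).filter (fun x => 0 < x ∧ ∃ h : x < n,
    (b ⟨x - 1, by omega⟩).val = (b ⟨x, h⟩).val + 1)

/-- common transition on sets -/
def G (m t : ℕ) (S : Finset ℕ) : Finset ℕ := if t = m then insert m S else S.erase t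

def insFixFun {m : ℕ} (t : Fin (m + 1)) (σ : Equiv.Perm (Fin m)) (i : Fin (m + 1)) : Fin (m + 1) :=
  if h : i.val < m then (if (σ ⟨i, h⟩).val = t.val then Fin.last m else (σ ⟨i, h⟩).castSucc) else t

theorem perm_val_inj {m : ℕ} (σ : Equiv.Perm (Fin m)) {i j : ℕ} (hi : i < m) (hj : j < m)
    (h : (σ ⟨i, hi⟩).val = (σ ⟨j, hj⟩).val) : i = j := by
  have := σ.injective (Fin.ext h)
  simpa using this

theorem insFix_inj {m : ℕ} (t : Fin (m + 1)) (σ : Equiv.Perm (Fin m)) :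
    Function.Injective (insFixFun t σ) := by
  intro i j hij
  have hv := congrArg Fin.val hij
  apply Fin.ext
  unfold insFixFun at hv
  have hi := i.isLt
  have hj := j.isLt
  split_ifs at hv with h1 h2 h3 h4 h3 h4 h5 h6 <;> simp only [Fin.val_last, Fin.val_castSucc] at hv
  all_goals first
    | omega
    | exact perm_val_inj σ _ _ (by omega)

noncomputable def insFix {m : ℕ} (q : Fin (m + 1) × Equiv.Perm (Fin m)) : Equiv.Perm (Fin (m + 1)) :=
  Equiv.ofBijective (insFixFun q.1 q.2) (Finite.injective_iff_bijective.1 (insFix_inj q.1 q.2))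

def posOf {m : ℕ} (t : Fin (m + 1)) (b : Equiv.Perm (Fin m)) : ℕ :=
  if h : t.val = 0 then m else (b ⟨t.val - 1, by omega⟩).val

theorem posOf_le {m : ℕ} (t : Fin (m + 1)) (b : Equiv.Perm (Fin m)) : posOf t b ≤ m := by
  unfold posOf
  split_ifs
  · exact le_rfl
  · exact (Fin.isLt _).le

def insAdjFun {m : ℕ} (t : Fin (m + 1)) (b : Equiv.Perm (Fin m)) (i : Fin (m + 1)) : Fin (m + 1) :=
  if h : i.val < m then
    (if (b ⟨i, h⟩).val < posOf t b then (b ⟨i, h⟩).castSucc else (b ⟨i, h⟩).succ)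
  else ⟨posOf t b, by have := posOf_le t b; omega⟩

theorem insAdj_inj {m : ℕ} (t : Fin (m + 1)) (b : Equiv.Perm (Fin m)) :
    Function.Injective (insAdjFun t b) := by
  intro i j hij
  have hv := congrArg Fin.val hij
  apply Fin.ext
  unfold insAdjFun at hv
  have hi := i.isLt
  have hj := j.isLt
  split_ifs at hv <;> simp only [Fin.val_succ, Fin.val_castSucc] at hv
  all_goals first
    | omega
    | exact perm_val_inj b _ _ (by omega)

noncomputable def insAdj {m : ℕ} (q : Fin (m + 1) × Equiv.Perm (Fin m)) : Equiv.Perm (Fin (m + 1)) :=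
  Equiv.ofBijective (insAdjFun q.1 q.2) (Finite.injective_iff_bijective.1 (insAdj_inj q.1 q.2))

theorem card_eq (m : ℕ) : Fintype.card (Fin (m + 1) × Equiv.Perm (Fin m))
    = Fintype.card (Equiv.Perm (Fin (m + 1))) := by
  simp [Fintype.card_perm, Nat.factorial_succ]

theorem insFix_bij (m : ℕ) : Function.Bijective (insFix (m := m)) := by
  rw [Fintype.bijective_iff_injective_and_card]
  refine ⟨?_, card_eq m⟩
  rintro ⟨t, σ⟩ ⟨t', σ'⟩ h
  have hf : ∀ i, insFixFun t σ i = insFixFun t' σ' i := fun i => congrArg (fun e => e i) h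
  have ht : t = t' := by
    have := hf (Fin.last m)
    simpa [insFixFun] using this
  subst ht
  congr 1
  ext i
  have hv := congrArg Fin.val (hf i.castSucc)
  have h1 := (σ i).isLt
  have h2 := (σ' i).isLt
  unfold insFixFun at hv
  have h3 : (i.castSucc).val < m := i.isLt
  simp only [h3, dif_pos] at hv
  change (if (σ i).val = t.val then Fin.last m else (σ i).castSucc).val
    = (if (σ' i).val = t.val then Fin.last m else (σ' i).castSucc).val at hv
  split_ifs at hv <;> simp only [Fin.val_last, Fin.val_castSucc] at hv <;> omega

theorem insAdj_bij (m : ℕ) : Function.Bijective (insAdj (m := m)) := by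
  rw [Fintype.bijective_iff_injective_and_card]
  refine ⟨?_, card_eq m⟩
  rintro ⟨t, σ⟩ ⟨t', σ'⟩ h
  have hf : ∀ i, insAdjFun t σ i = insAdjFun t' σ' i := fun i => congrArg (fun e => e i) h
  have hp : posOf t σ = posOf t' σ' := by
    have := hf (Fin.last m)
    simpa [insAdjFun] using this
  have hs : σ = σ' := by
    ext i
    have hv := congrArg Fin.val (hf i.castSucc)
    unfold insAdjFun at hv
    have h3 : (i.castSucc).val < m := i.isLt
    simp only [h3, dif_pos] at hv
    change (if (σ i).val < posOf t σ then (σ i).castSucc else (σ i).succ).val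
      = (if (σ' i).val < posOf t' σ' then (σ' i).castSucc else (σ' i).succ).val at hv
    split_ifs at hv <;> simp only [Fin.val_succ, Fin.val_castSucc] at hv <;> omega
  subst hs
  congr 1
  unfold posOf at hp
  apply Fin.ext
  split_ifs at hp
  · omega
  · have := (σ ⟨t'.val - 1, by omega⟩).isLt; omega
  · have := (σ ⟨t.val - 1, by omega⟩).isLt; omega
  · have := perm_val_inj σ _ _ hp
    omega

theorem fixS_ins {m : ℕ} (hm : 0 < m) (t : Fin (m + 1)) (σ : Equiv.Perm (Fin m)) :
    fixS (insFix (t, σ)) = G m t (fixS σ) := by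
  ext i
  have key : ∀ h : i < m + 1, (insFix (t, σ) ⟨i, h⟩).val = if h : i < m then
      (if (σ ⟨i, h⟩).val = t.val then m else (σ ⟨i, h⟩).val) else t.val := by
    intro h
    change (insFixFun t σ ⟨i, h⟩).val = _
    unfold insFixFun
    dsimp only
    split_ifs <;> simp
  have ht := t.isLt
  rcases lt_trichotomy i m with hi | hi | hi
  · have hi' : i < m + 1 := by omega
    have h1 := (σ ⟨i, hi⟩).isLt
    have : i ∈ fixS (insFix (t, σ)) ↔ 0 < i ∧ (σ ⟨i, hi⟩).val = i ∧ i ≠ t.val := by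
      simp only [fixS, Finset.mem_filter, Finset.mem_range, hi', exists_true_left, key, hi, dif_pos, true_and]
      split_ifs <;> omega
    rw [this]
    unfold G
    split_ifs with h
    · simp [fixS, hi]; omega
    · simp [fixS, hi]; tauto
  · subst hi
    have : i ∈ fixS (insFix (t, σ)) ↔ t.val = i := by
      simp [fixS, key, hm]
    rw [this]
    unfold G
    split_ifs with h <;> simp [h, fixS]
  · have a1 : ¬ i < m + 1 := by omega
    have a2 : ¬ i < m := by omega
    have a3 : i ≠ m := by omega
    unfold G
    split_ifs <;> simp [fixS, a1, a2, a3]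

theorem adjS_ins {m : ℕ} (hm : 0 < m) (t : Fin (m + 1)) (b : Equiv.Perm (Fin m)) :
    adjS (insAdj (t, b)) = G m t (adjS b) := by
  have key : ∀ i, ∀ h : i < m + 1, (insAdj (t, b) ⟨i, h⟩).val = if h : i < m then
      (if (b ⟨i, h⟩).val < posOf t b then (b ⟨i, h⟩).val else (b ⟨i, h⟩).val + 1)
      else posOf t b := by
    intro i h
    change (insAdjFun t b ⟨i, h⟩).val = _
    unfold insAdjFun
    dsimp only
    split_ifs <;> simp
  have ht := t.isLt
  have hpos : ∀ i, ∀ h : i < m, (posOf t b = (b ⟨i, h⟩).val ↔ t.val = i + 1) := by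
    intro i h
    have h1 := (b ⟨i, h⟩).isLt
    unfold posOf
    split_ifs with h0
    · omega
    · constructor
      · intro h2
        have := perm_val_inj b _ _ h2
        omega
      · intro h2
        simp [h2]
  ext i
  rcases lt_trichotomy i m with hi | hi | hi
  · have hi' : i < m + 1 := by omega
    have hi1 : i - 1 < m := by omega
    have hp := hpos (i - 1) hi1
    have : i ∈ adjS (insAdj (t, b)) ↔ 0 < i ∧ (b ⟨i - 1, hi1⟩).val = (b ⟨i, hi⟩).val + 1 ∧ i ≠ t.val := by
      simp only [adjS, Finset.mem_filter, Finset.mem_range, hi', exists_true_left, key, hi, hi1, dif_pos, true_and]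
      by_cases h0 : 0 < i
      · have hp' : posOf t b = (b ⟨i - 1, hi1⟩).val ↔ t.val = i := by rw [hp]; omega
        split_ifs <;> omega
      · simp [h0]
    rw [this]
    unfold G
    split_ifs with h
    · simp [adjS, hi]; omega
    · simp [adjS, hi]; tauto
  · subst hi
    have hi1 : i - 1 < i := by omega
    have hp := hpos (i - 1) hi1
    have hp' : posOf t b = (b ⟨i - 1, hi1⟩).val ↔ t.val = i := by rw [hp]; omega
    have : i ∈ adjS (insAdj (t, b)) ↔ t.val = i := by
      simp only [adjS, Finset.mem_filter, Finset.mem_range, key, hi1, dif_pos, lt_irrefl, dif_neg,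
        Nat.lt_succ_self, exists_true_left, true_and, hm, not_false_eq_true]
      split_ifs <;> omega
    rw [this]
    unfold G
    split_ifs with h <;> simp [h, adjS]
  · have a1 : ¬ i < m + 1 := by omega
    have a2 : ¬ i < m := by omega
    have a3 : i ≠ m := by omega
    unfold G
    split_ifs <;> simp [adjS, a1, a2, a3]

theorem equidist (n : ℕ) (w : Finset ℕ → ℕ) :
    ∑ σ : Equiv.Perm (Fin (n + 1)), w (fixS σ) = ∑ b : Equiv.Perm (Fin (n + 1)), w (adjS b) := by
  induction n generalizing w with
  | zero =>
    apply Finset.sum_congr rfl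
    intro σ _
    congr 1
  | succ n ih =>
    rw [← (insFix_bij (n + 1)).sum_comp, ← (insAdj_bij (n + 1)).sum_comp]
    rw [Fintype.sum_prod_type_right, Fintype.sum_prod_type_right]
    simp only [fixS_ins (Nat.succ_pos n), adjS_ins (Nat.succ_pos n)]
    exact ih (fun S => ∑ t : Fin (n + 1 + 1), w (G (n + 1) t S))

/-- the word of a permutation -/
def word {n : ℕ} (σ : Equiv.Perm (Fin n)) (i : ℕ) : ℕ :=
  if h : 1 ≤ i ∧ i ≤ n then (σ ⟨i - 1, by omega⟩).val + 1 else 0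

theorem word_pos {n : ℕ} (σ : Equiv.Perm (Fin n)) {i : ℕ} (h1 : 1 ≤ i) (h2 : i ≤ n) :
    word σ i = (σ ⟨i - 1, by omega⟩).val + 1 := by
  unfold word
  rw [dif_pos ⟨h1, h2⟩]

theorem word_inj {n : ℕ} : Function.Injective (word (n := n)) := by
  intro σ τ h
  ext i
  have := congrFun h (i.val + 1)
  rw [word_pos σ (by omega) (by omega), word_pos τ (by omega) (by omega)] at this
  simpa using this

theorem word_isPerm {n : ℕ} (σ : Equiv.Perm (Fin n)) : IsPermOn n (word σ) := by
  refine ⟨⟨?_, ?_, ?_⟩, ?_⟩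
  · rintro i ⟨h1, h2⟩
    rw [word_pos σ h1 h2]
    have := (σ ⟨i - 1, by omega⟩).isLt
    constructor <;> omega
  · rintro i ⟨h1, h2⟩ j ⟨h3, h4⟩ h
    rw [word_pos σ h1 h2, word_pos σ h3 h4] at h
    have := perm_val_inj σ _ _ (Nat.succ_injective h)
    omega
  · rintro j ⟨h1, h2⟩
    refine ⟨(σ.symm ⟨j - 1, by omega⟩).val + 1, ⟨by omega, by omega⟩, ?_⟩
    rw [word_pos σ (by omega) (by omega)]
    simp
    omega
  · intro i hi
    unfold word
    exact dif_neg hi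

theorem word_surj {n : ℕ} (a : ℕ → ℕ) (ha : IsPermOn n a) : ∃ σ : Equiv.Perm (Fin n), word σ = a := by
  obtain ⟨⟨hm, hi, -⟩, h0⟩ := ha
  have hm' : ∀ i : Fin n, 1 ≤ a (i + 1) ∧ a (i + 1) ≤ n := fun i => hm ⟨by omega, by omega⟩
  let f : Fin n → Fin n := fun i => ⟨a (i + 1) - 1, by have := hm' i; omega⟩
  have hf : Function.Injective f := by
    intro i j h
    have h' : a (i + 1) - 1 = a (j + 1) - 1 := congrArg Fin.val h
    have h1 := hm' i
    have h2 := hm' j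
    have := hi (x₁ := i.val + 1) (x₂ := j.val + 1) ⟨by omega, by omega⟩ ⟨by omega, by omega⟩ (by omega)
    apply Fin.ext
    omega
  refine ⟨Equiv.ofBijective f (Finite.injective_iff_bijective.1 hf), ?_⟩
  funext i
  by_cases h : 1 ≤ i ∧ i ≤ n
  · rw [word_pos _ h.1 h.2]
    have h1 := hm' ⟨i - 1, by omega⟩
    change a (i - 1 + 1) - 1 + 1 = a i
    simp only at h1
    rw [Nat.sub_add_cancel h1.1, Nat.sub_add_cancel h.1]
  · unfold word
    rw [dif_neg h, h0 i h]

theorem card_transfer (n : ℕ) (Q : (ℕ → ℕ) → Prop) :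
    Nat.card {a : ℕ → ℕ // IsPermOn n a ∧ Q a} = Nat.card {σ : Equiv.Perm (Fin n) // Q (word σ)} := by
  symm
  refine Nat.card_congr (Equiv.ofBijective
    (fun σ => ⟨word σ.1, word_isPerm σ.1, σ.2⟩) ⟨?_, ?_⟩)
  · intro σ τ h
    exact Subtype.ext (word_inj (congrArg Subtype.val h))
  · rintro ⟨a, ha, hq⟩
    obtain ⟨σ, rfl⟩ := word_surj a ha
    exact ⟨⟨σ, hq⟩, rfl⟩

theorem ncard_fix {n : ℕ} (σ : Equiv.Perm (Fin n)) :
    Set.ncard {i | 2 ≤ i ∧ i ≤ n ∧ word σ i = i} = (fixS σ).card := by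
  rw [← Set.ncard_coe_finset]
  symm
  refine Set.ncard_congr (fun i _ => i + 1) ?_ ?_ ?_
  · intro i hi
    simp only [fixS, Finset.coe_filter, Finset.mem_range, Set.mem_ofPred_eq] at hi
    obtain ⟨h1, h2, h3, h4⟩ := hi
    refine ⟨by omega, by omega, ?_⟩
    rw [word_pos _ (by omega) (by omega)]
    simpa using h4
  · intro i j _ _ h
    omega
  · rintro i ⟨h1, h2, h3⟩
    rw [word_pos _ (by omega) (by omega)] at h3
    refine ⟨i - 1, ?_, by omega⟩
    simp only [fixS, Finset.coe_filter, Finset.mem_range, Set.mem_ofPred_eq]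
    exact ⟨by omega, by omega, by omega, by omega⟩

theorem ncard_adj {n : ℕ} (b : Equiv.Perm (Fin n)) :
    Set.ncard {i | 1 ≤ i ∧ i < n ∧ word b.symm i = word b.symm (i + 1) + 1} = (adjS b).card := by
  rw [← Set.ncard_coe_finset]
  refine Set.ncard_congr (fun i _ => word b.symm i - 1) ?_ ?_ ?_
  · rintro i ⟨h1, h2, h3⟩
    rw [word_pos _ (by omega) (by omega), word_pos _ (by omega) (by omega)] at h3
    simp only [adjS, Finset.coe_filter, Finset.mem_range, Set.mem_ofPred_eq]
    rw [word_pos _ (by omega) (by omega)]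
    have hlt := (b.symm ⟨i - 1, by omega⟩).isLt
    refine ⟨by omega, by omega, by omega, ?_⟩
    have e1 : (⟨(b.symm ⟨i - 1, by omega⟩).val + 1 - 1 - 1, by omega⟩ : Fin n)
        = b.symm ⟨i + 1 - 1, by omega⟩ := by
      apply Fin.ext
      simp only at h3 ⊢
      omega
    have e2 : (⟨(b.symm ⟨i - 1, by omega⟩).val + 1 - 1, by omega⟩ : Fin n)
        = b.symm ⟨i - 1, by omega⟩ := by
      apply Fin.ext
      simp
    rw [e1, e2]
    simp
    omega
  · rintro i j ⟨h1, h2, -⟩ ⟨h3, h4, -⟩ h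
    rw [word_pos _ (by omega) (by omega), word_pos _ (by omega) (by omega)] at h
    have := perm_val_inj b.symm _ _ (by simpa using h)
    omega
  · intro x hx
    simp only [adjS, Finset.coe_filter, Finset.mem_range, Set.mem_ofPred_eq] at hx
    obtain ⟨h1, h2, h3, h4⟩ := hx
    have hlt := (b ⟨x - 1, by omega⟩).isLt
    have w1 : word b.symm ((b ⟨x, h3⟩).val + 1) = x + 1 := by
      rw [word_pos _ (by omega) (by omega)]
      simp
    have w2 : word b.symm ((b ⟨x, h3⟩).val + 1 + 1) = x := by
      rw [← h4, word_pos _ (by omega) (by omega)]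
      simp
      omega
    refine ⟨(b ⟨x, h3⟩).val + 1, ⟨by omega, by omega, ?_⟩, ?_⟩
    · rw [w1, w2]
    · rw [w1]; rfl

theorem card_sum {α : Type} [Fintype α] (f : α → ℕ) (k : ℕ) :
    Nat.card {x : α // f x = k} = ∑ x : α, if f x = k then 1 else 0 := by
  rw [Nat.card_eq_fintype_card, Fintype.card_subtype, Finset.card_filter]

end FPDA

/-- for every `n ≥ 1` and `k ≥ 0`, the number of `n`-permutations
with exactly `k` fixed points different from 1 (indices `i ≥ 2` with `a_i = i`)
equals the number of `n`-permutations with exactly `k` decreasing adjacencies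
(indices `i` with `a_i = a_{i+1} + 1`). -/
theorem fixedPointsNeOne_eq_decreasingAdjacencies (n k : ℕ) (hn : 0 < n) :
    Nat.card {a : ℕ → ℕ // IsPermOn n a ∧
        Set.ncard {i | 2 ≤ i ∧ i ≤ n ∧ a i = i} = k}
      = Nat.card {a : ℕ → ℕ // IsPermOn n a ∧
          Set.ncard {i | 1 ≤ i ∧ i < n ∧ a i = a (i + 1) + 1} = k} := by
  obtain ⟨m, rfl⟩ : ∃ m, n = m + 1 := ⟨n - 1, by omega⟩
  rw [FPDA.card_transfer, FPDA.card_transfer]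
  have h2 : Nat.card {σ : Equiv.Perm (Fin (m + 1)) //
      Set.ncard {i | 1 ≤ i ∧ i < m + 1 ∧ FPDA.word σ i = FPDA.word σ (i + 1) + 1} = k}
      = Nat.card {b : Equiv.Perm (Fin (m + 1)) // (FPDA.adjS b).card = k} := by
    symm
    refine Nat.card_congr (Equiv.subtypeEquiv (Equiv.inv (Equiv.Perm (Fin (m + 1)))) ?_)
    intro b
    rw [← FPDA.ncard_adj b]
    rfl
  rw [h2]
  simp only [FPDA.ncard_fix]
  rw [FPDA.card_sum, FPDA.card_sum]
  exact FPDA.equidist m (fun S => if S.card = k then 1 else 0)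
end

section
/- Every domination-free NEW-tableau is top-justified, i.e., in a NEW-tableau in which no row dominates another, no cell containing a 1 has a cell containing a 0 above it in its column. -/
/-- every domination-free NEW-tableau is top-justified.  Here the
tableau is domination-free when no row dominates another: for every row `r'` and
every row `s` above it there is a column in which row `r'` has a 0 and row `s`
has a 1.  Top-justified: no cell containing a 1 has a cell containing a 0 above
it in its column. -/
theorem dominationFree_impl_topJustified (F : FerrersShapeN) (T : NEWTableau F)
    (hdf : ∀ s r', s < r' → r' < F.r →
      ∃ j, j < F.len r' ∧ T.one r' j = false ∧ T.one s j = true) :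
    ∀ i i' j, i < i' → i' < F.r → j < F.len i' →
      T.one i' j = true → T.one i j = true := by
  intro i i' j hi hr hj h1
  by_contra h0
  have h0 : T.one i j = false := by simpa using h0
  obtain ⟨k, hk, hk0, hk1⟩ := hdf i i' hi hr
  rcases lt_trichotomy j k with h | h | h
  · exact T.no_rect i i' j k hi hr h hk (by simp [*])
  · subst h
    simp [h1] at hk0
  · exact T.no_rect i i' k j hi hr h hj (by simp [*])
end
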